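/- Let Ω be a nonempty finite set and let l, u : Ω → ℝ satisfy 0 ≤ l(ω) ≤ u(ω) ≤ 1 for all ω ∈ Ω. Assume ∑_{ω∈Ω} l(ω) ≤ 1 ≤ ∑_{ω∈Ω} u(ω), and assume that for every ω ∈ Ω, u(ω) + ∑_{j∈Ω, j≠ω} l(j) ≤ 1. Then for every ω ∈ Ω there exists p in the credal set K = {p : Ω → ℝ | ∀ω', l(ω') ≤ p(ω') ≤ u(ω'), and ∑_{ω'∈Ω} p(ω') = 1} with p(ω) = u(ω); that is, every upper bound is reachable. -/

import Mathlib

/-- Any value between the sums of two pointwise ordered functions is the sum of a function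
lying between them. -/
theorem exists_between_sum_eq {ι : Type*} [Fintype ι] {a b : ι → ℝ} (hab : ∀ i, a i ≤ b i)
    {c : ℝ} (ha : ∑ i, a i ≤ c) (hb : c ≤ ∑ i, b i) :
    ∃ p : ι → ℝ, (∀ i, a i ≤ p i ∧ p i ≤ b i) ∧ ∑ i, p i = c := by
  have hc : c ∈ segment ℝ (∑ i, a i) (∑ i, b i) := by
    rw [segment_eq_Icc (ha.trans hb)]
    exact ⟨ha, hb⟩
  obtain ⟨s, t, hs, ht, hst, h⟩ := hc
  refine ⟨fun i => s * a i + t * b i, fun i => ⟨?_, ?_⟩, ?_⟩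
  · linear_combination t * hab i - a i * hst
  · linear_combination s * hab i + b i * hst
  · simpa [Finset.sum_add_distrib, Finset.mul_sum] using h

/-- Under conditions (2) and the second half of (3), every upper bound is reachable
by some distribution in the credal set. -/
theorem upper_bound_reachable {Ω : Type*} [Fintype Ω] [Nonempty Ω] [DecidableEq Ω]
    (l u : Ω → ℝ)
    (hbounds : ∀ ω, 0 ≤ l ω ∧ l ω ≤ u ω ∧ u ω ≤ 1)
    (hsum : ∑ ω, l ω ≤ 1 ∧ 1 ≤ ∑ ω, u ω)
    (h3 : ∀ ω : Ω, u ω + ∑ j ∈ Finset.univ.erase ω, l j ≤ 1) :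
    ∀ ω : Ω, ∃ p ∈ {p : Ω → ℝ | (∀ ω', l ω' ≤ p ω' ∧ p ω' ≤ u ω') ∧ ∑ ω', p ω' = 1},
      p ω = u ω := by
  intro ω
  have hle : ∀ i, Function.update l ω (u ω) i ≤ u i :=
    update_le_iff.2 ⟨le_rfl, fun i _ => (hbounds i).2.1⟩
  have hlower : ∑ i, Function.update l ω (u ω) i ≤ 1 := by
    rw [Finset.sum_update_of_mem (Finset.mem_univ ω), Finset.sdiff_singleton_eq_erase]
    exact h3 ω
  obtain ⟨p, hp, hp1⟩ := exists_between_sum_eq hle hlower hsum.2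
  have hl : l ≤ Function.update l ω (u ω) :=
    le_update_iff.2 ⟨(hbounds ω).2.1, fun _ _ => le_rfl⟩
  refine ⟨p, ⟨fun i => ⟨(hl i).trans (hp i).1, (hp i).2⟩, hp1⟩, (hp ω).2.antisymm ?_⟩
  simpa using (hp ω).1
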